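/- There exists D > 0 depending only on C₀ such that the following holds: if ε, β > 0 satisfy β ≤ D²ε⁴ and u is an admissible solution of (★★) whose initial datum satisfies ‖u(0,·)‖²_{L²(ℝ)} + ‖u(0,·)‖⁴_{L⁴(ℝ)} + βε²‖∂_x² u(0,·)‖²_{L²(ℝ)} ≤ C₀ as well as ‖u(0,·)‖²_{L²(ℝ)} + β‖∂_x u(0,·)‖²_{L²(ℝ)} + β²‖∂_x² u(0,·)‖²_{L²(ℝ)} ≤ C₀, then there is a constant C depending only on C₀ such that for every t > 0: βε ∫₀ᵗ‖∂_t∂_x u(s,·)‖²_{L²(ℝ)} ds ≤ C, β²ε ∫₀ᵗ‖∂_t∂_x² u(s,·)‖²_{L²(ℝ)} ds ≤ C, β³ε ∫₀ᵗ‖∂_t∂_x³ u(s,·)‖²_{L²(ℝ)} ds ≤ C, and ε ∫₀ᵗ‖u(s,·)∂_x u(s,·)‖²_{L²(ℝ)} ds ≤ C. -/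

import Mathlib

open MeasureTheory Real Filter Set

noncomputable section

/-- `mixedD u j k t x`: `j` time derivatives of the `k`-th spatial derivative of `u` at `(t,x)`. -/
def mixedD (u : ℝ → ℝ → ℝ) (j k : ℕ) (t x : ℝ) : ℝ :=
  iteratedDeriv j (fun s => iteratedDeriv k (fun y => u s y) x) t

/-- Squared `L²` norm in the space variable. -/
def sqL2 (f : ℝ → ℝ) : ℝ := ∫ x : ℝ, (f x) ^ 2

/-- `L²` norm in the space variable. -/
def nL2 (f : ℝ → ℝ) : ℝ := Real.sqrt (∫ x : ℝ, (f x) ^ 2)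

/-- `L⁴` norm in the space variable. -/
def nL4 (f : ℝ → ℝ) : ℝ := (∫ x : ℝ, (f x) ^ 4) ^ ((1 : ℝ) / 4)

/-- Admissible solution of the Rosenau–KdV–RLW approximation (★). -/
structure IsAdmissibleKdVRLW (ε β : ℝ) (u : ℝ → ℝ → ℝ) : Prop where
  smooth : ContDiff ℝ (⊤ : ℕ∞) (fun p : ℝ × ℝ => u p.1 p.2)
  pde : ∀ t > (0 : ℝ), ∀ x : ℝ,
    mixedD u 1 0 t x + deriv (fun y => (u t y) ^ 2) x
      + β * mixedD u 0 3 t x - β * mixedD u 1 2 t x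
      + β ^ 2 * mixedD u 1 4 t x = ε * mixedD u 0 2 t x
  sq_int : ∀ T > (0 : ℝ), ∀ j k : ℕ, j + k ≤ 5 → ∀ t ∈ Set.Icc (0 : ℝ) T,
    MeasureTheory.Integrable (fun x : ℝ => (mixedD u j k t x) ^ 2)
  decay : ∀ T > (0 : ℝ), ∀ j k : ℕ, j + k ≤ 5 → ∀ δ > (0 : ℝ), ∃ M : ℝ,
    ∀ x : ℝ, M ≤ |x| → ∀ t ∈ Set.Icc (0 : ℝ) T, |mixedD u j k t x| ≤ δ

/-- Admissible solution of the Rosenau–RLW approximation (★★). -/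
structure IsAdmissibleRLW (ε β : ℝ) (u : ℝ → ℝ → ℝ) : Prop where
  smooth : ContDiff ℝ (⊤ : ℕ∞) (fun p : ℝ × ℝ => u p.1 p.2)
  pde : ∀ t > (0 : ℝ), ∀ x : ℝ,
    mixedD u 1 0 t x + deriv (fun y => (u t y) ^ 2) x
      - β * mixedD u 1 2 t x + β ^ 2 * mixedD u 1 4 t x = ε * mixedD u 0 2 t x
  sq_int : ∀ T > (0 : ℝ), ∀ j k : ℕ, j + k ≤ 5 → ∀ t ∈ Set.Icc (0 : ℝ) T,
    MeasureTheory.Integrable (fun x : ℝ => (mixedD u j k t x) ^ 2)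
  decay : ∀ T > (0 : ℝ), ∀ j k : ℕ, j + k ≤ 5 → ∀ δ > (0 : ℝ), ∃ M : ℝ,
    ∀ x : ℝ, M ≤ |x| → ∀ t ∈ Set.Icc (0 : ℝ) T, |mixedD u j k t x| ≤ δ

/-- Data bounds with constant `C0` for the (★) approximation. -/
def DataBoundsKdVRLW (ε β C0 : ℝ) (f : ℝ → ℝ) : Prop :=
  (∫ x : ℝ, (f x) ^ 2) + (∫ x : ℝ, (f x) ^ 4)
      + (β + ε ^ 2) * (∫ x : ℝ, (deriv f x) ^ 2) ≤ C0 ∧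
  (β * ε + β * ε ^ 2 + β ^ 2) * (∫ x : ℝ, (iteratedDeriv 2 f x) ^ 2)
      + (β ^ 2 * ε ^ 2 + β ^ 3) * (∫ x : ℝ, (iteratedDeriv 3 f x) ^ 2) ≤ C0 ∧
  β ^ 4 * (∫ x : ℝ, (iteratedDeriv 4 f x) ^ 2) ≤ C0

/-- Data bounds with constant `C0` for the (★★) approximation. -/
def DataBoundsRLW (ε β C0 : ℝ) (f : ℝ → ℝ) : Prop :=
  (∫ x : ℝ, (f x) ^ 2) + (∫ x : ℝ, (f x) ^ 4)
    + β * ε ^ 2 * (∫ x : ℝ, (iteratedDeriv 2 f x) ^ 2) ≤ C0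

/-- `u ∈ L^∞((0,∞); L²(ℝ) ∩ L⁴(ℝ))`. -/
def BddL2L4 (u : ℝ → ℝ → ℝ) : Prop :=
  ∃ M : ℝ, ∀ t > (0 : ℝ), (∫ x : ℝ, (u t x) ^ 2) ≤ M ∧ (∫ x : ℝ, (u t x) ^ 4) ≤ M

/-- Entropy solution of `∂ₜ u + ∂ₓ (u²) = 0` with initial datum `u0`. -/
def IsEntropySolution (u : ℝ → ℝ → ℝ) (u0 : ℝ → ℝ) : Prop :=
  ∀ η : ℝ → ℝ, ContDiff ℝ 2 η → ConvexOn ℝ Set.univ η →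
    (∃ M : ℝ, ∀ v : ℝ, |deriv η v| ≤ M) →
    ∀ φ : ℝ → ℝ → ℝ, ContDiff ℝ (⊤ : ℕ∞) (fun p : ℝ × ℝ => φ p.1 p.2) →
      HasCompactSupport (fun p : ℝ × ℝ => φ p.1 p.2) →
      (∀ t x : ℝ, 0 ≤ φ t x) →
      0 ≤ (∫ t in Set.Ioi (0 : ℝ), ∫ x : ℝ,
            (η (u t x) * deriv (fun s => φ s x) t
              + (∫ ξ in (0 : ℝ)..(u t x), 2 * ξ * deriv η ξ) * deriv (fun y => φ t y) x))
          + ∫ x : ℝ, η (u0 x) * φ 0 x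

theorem hasDerivAt_fst_of_contDiff {w : ℝ → ℝ → ℝ}
    (hw : ContDiff ℝ (⊤ : ℕ∞) (fun p : ℝ × ℝ => w p.1 p.2)) (t x : ℝ) :
    HasDerivAt (fun s => w s x) (fderiv ℝ (fun p : ℝ × ℝ => w p.1 p.2) (t, x) (1, 0)) t := by
  have h := (hw.differentiable (by simp) (t, x)).hasFDerivAt
  have hg : HasDerivAt (fun s : ℝ => (s, x)) ((1 : ℝ), (0 : ℝ)) t :=
    (hasDerivAt_id t).prodMk (hasDerivAt_const t x)
  exact h.comp_hasDerivAt t hg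

theorem hasDerivAt_snd_of_contDiff {w : ℝ → ℝ → ℝ}
    (hw : ContDiff ℝ (⊤ : ℕ∞) (fun p : ℝ × ℝ => w p.1 p.2)) (t x : ℝ) :
    HasDerivAt (fun y => w t y) (fderiv ℝ (fun p : ℝ × ℝ => w p.1 p.2) (t, x) (0, 1)) x := by
  have h := (hw.differentiable (by simp) (t, x)).hasFDerivAt
  have hg : HasDerivAt (fun y : ℝ => (t, y)) ((0 : ℝ), (1 : ℝ)) x :=
    (hasDerivAt_const x t).prodMk (hasDerivAt_id x)
  exact h.comp_hasDerivAt x hg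

theorem contDiff_fderiv_apply {f : ℝ × ℝ → ℝ} (hf : ContDiff ℝ (⊤ : ℕ∞) f) (v : ℝ × ℝ) :
    ContDiff ℝ (⊤ : ℕ∞) (fun p => fderiv ℝ f p v) :=
  (hf.fderiv_right (m := (⊤ : ℕ∞)) (by simp)).clm_apply contDiff_const

theorem contDiff_deriv_fst {w : ℝ → ℝ → ℝ}
    (hw : ContDiff ℝ (⊤ : ℕ∞) (fun p : ℝ × ℝ => w p.1 p.2)) :
    ContDiff ℝ (⊤ : ℕ∞) (fun p : ℝ × ℝ => deriv (fun s => w s p.2) p.1) := by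
  simpa only [(hasDerivAt_fst_of_contDiff hw _ _).deriv] using contDiff_fderiv_apply hw (1, 0)

theorem contDiff_deriv_snd {w : ℝ → ℝ → ℝ}
    (hw : ContDiff ℝ (⊤ : ℕ∞) (fun p : ℝ × ℝ => w p.1 p.2)) :
    ContDiff ℝ (⊤ : ℕ∞) (fun p : ℝ × ℝ => deriv (fun y => w p.1 y) p.2) := by
  simpa only [(hasDerivAt_snd_of_contDiff hw _ _).deriv] using contDiff_fderiv_apply hw (0, 1)

/-- Mixed second partial derivatives of a smooth function commute. -/
theorem deriv_fst_snd_comm {w : ℝ → ℝ → ℝ}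
    (hw : ContDiff ℝ (⊤ : ℕ∞) (fun p : ℝ × ℝ => w p.1 p.2)) (t x : ℝ) :
    deriv (fun y => deriv (fun s => w s y) t) x = deriv (fun s => deriv (fun y => w s y) x) t := by
  set W : ℝ × ℝ → ℝ := fun p => w p.1 p.2 with hW
  have hsymm : IsSymmSndFDerivAt ℝ W (t, x) :=
    hw.contDiffAt.isSymmSndFDerivAt (by
      simpa using WithTop.coe_le_coe.2 (le_top : (2 : ℕ∞) ≤ ⊤))
  have hd : DifferentiableAt ℝ (fderiv ℝ W) (t, x) :=
    (hw.fderiv_right (m := (⊤ : ℕ∞)) (by simp)).differentiable (by simp) _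
  have key (v : ℝ × ℝ) : fderiv ℝ (fun p => fderiv ℝ W p v) (t, x)
      = (fderiv ℝ (fderiv ℝ W) (t, x)).flip v := by
    ext <;> simp [fderiv_clm_apply hd (differentiableAt_const v)]
  have h1 := hasDerivAt_snd_of_contDiff (w := fun s y => fderiv ℝ W (s, y) (1, 0))
    (contDiff_fderiv_apply hw (1, 0)) t x
  have h2 := hasDerivAt_fst_of_contDiff (w := fun s y => fderiv ℝ W (s, y) (0, 1))
    (contDiff_fderiv_apply hw (0, 1)) t x
  simp only [(hasDerivAt_fst_of_contDiff hw _ _).deriv, (hasDerivAt_snd_of_contDiff hw _ _).deriv]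
  rw [h1.deriv, h2.deriv]
  simp only [Prod.mk.eta, key]
  exact hsymm _ _

theorem contDiff_mixedD {u : ℝ → ℝ → ℝ}
    (hu : ContDiff ℝ (⊤ : ℕ∞) (fun p : ℝ × ℝ => u p.1 p.2)) (j k : ℕ) :
    ContDiff ℝ (⊤ : ℕ∞) (fun p : ℝ × ℝ => mixedD u j k p.1 p.2) := by
  induction j with
  | zero =>
    induction k with
    | zero => simpa [mixedD] using hu
    | succ k ih => simpa [mixedD, iteratedDeriv_succ] using contDiff_deriv_snd ih
  | succ j ih => simpa only [mixedD, iteratedDeriv_succ] using contDiff_deriv_fst ih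

theorem hasDerivAt_mixedD_time {u : ℝ → ℝ → ℝ}
    (hu : ContDiff ℝ (⊤ : ℕ∞) (fun p : ℝ × ℝ => u p.1 p.2)) (j k : ℕ) (t x : ℝ) :
    HasDerivAt (fun s => mixedD u j k s x) (mixedD u (j + 1) k t x) t := by
  have h := (hasDerivAt_fst_of_contDiff (contDiff_mixedD hu j k) t x).differentiableAt.hasDerivAt
  simpa only [mixedD, iteratedDeriv_succ] using h

theorem deriv_mixedD_space {u : ℝ → ℝ → ℝ}
    (hu : ContDiff ℝ (⊤ : ℕ∞) (fun p : ℝ × ℝ => u p.1 p.2)) (j k : ℕ) (t x : ℝ) :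
    deriv (fun y => mixedD u j k t y) x = mixedD u j (k + 1) t x := by
  induction j generalizing t with
  | zero => simp [mixedD, iteratedDeriv_succ]
  | succ j ih =>
    have h (y : ℝ) : mixedD u (j + 1) k t y = deriv (fun s => mixedD u j k s y) t := by
      simp only [mixedD, iteratedDeriv_succ]
    simp only [h]
    rw [deriv_fst_snd_comm (contDiff_mixedD hu j k)]
    simp only [ih]
    simp only [mixedD, iteratedDeriv_succ]

theorem hasDerivAt_mixedD_space {u : ℝ → ℝ → ℝ}
    (hu : ContDiff ℝ (⊤ : ℕ∞) (fun p : ℝ × ℝ => u p.1 p.2)) (j k : ℕ) (t x : ℝ) :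
    HasDerivAt (fun y => mixedD u j k t y) (mixedD u j (k + 1) t x) x := by
  rw [← deriv_mixedD_space hu]
  exact (hasDerivAt_snd_of_contDiff (contDiff_mixedD hu j k) t x).differentiableAt.hasDerivAt

/-- Integrated form of a balance law `∂ₜ e + ∂ₓ f = g` over a rectangle. -/
theorem integral_balance {e et f fx : ℝ → ℝ → ℝ}
    (het : Continuous (fun p : ℝ × ℝ => et p.1 p.2))
    (hfx : Continuous (fun p : ℝ × ℝ => fx p.1 p.2))
    (hf : Continuous (fun p : ℝ × ℝ => f p.1 p.2))
    (he : ∀ t, Continuous (e t))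
    (hde : ∀ t x, HasDerivAt (fun s => e s x) (et t x) t)
    (hdf : ∀ t x, HasDerivAt (fun y => f t y) (fx t x) x) (t a b : ℝ) :
    (∫ s in (0 : ℝ)..t, ∫ x in a..b, (et s x + fx s x))
      = (∫ x in a..b, e t x) - (∫ x in a..b, e 0 x)
        + ((∫ s in (0 : ℝ)..t, f s b) - ∫ s in (0 : ℝ)..t, f s a) := by
  have cet (s : ℝ) : Continuous (et s) := het.comp (by fun_prop : Continuous fun x => (s, x))
  have cfx (s : ℝ) : Continuous (fx s) := hfx.comp (by fun_prop : Continuous fun x => (s, x))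
  have cet' (x : ℝ) : Continuous (fun s => et s x) :=
    het.comp (by fun_prop : Continuous fun s => (s, x))
  have cf (x : ℝ) : Continuous (fun s => f s x) :=
    hf.comp (by fun_prop : Continuous fun s => (s, x))
  have Iet : Continuous (fun s => ∫ x in a..b, et s x) :=
    intervalIntegral.continuous_parametric_intervalIntegral_of_continuous' het a b
  have Ifx : Continuous (fun s => ∫ x in a..b, fx s x) :=
    intervalIntegral.continuous_parametric_intervalIntegral_of_continuous' hfx a b
  have h1 : (∫ s in (0 : ℝ)..t, ∫ x in a..b, (et s x + fx s x))
      = (∫ s in (0 : ℝ)..t, ∫ x in a..b, et s x) + ∫ s in (0 : ℝ)..t, ∫ x in a..b, fx s x := by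
    rw [← intervalIntegral.integral_add (Iet.intervalIntegrable _ _) (Ifx.intervalIntegrable _ _)]
    refine intervalIntegral.integral_congr fun s _ => ?_
    exact intervalIntegral.integral_add ((cet s).intervalIntegrable _ _)
      ((cfx s).intervalIntegrable _ _)
  have h2 : (∫ s in (0 : ℝ)..t, ∫ x in a..b, et s x)
      = ∫ x in a..b, ∫ s in (0 : ℝ)..t, et s x := by
    apply MeasureTheory.intervalIntegral_intervalIntegral_swap
    exact (het.continuousOn.integrableOn_compact
      (isCompact_uIcc.prod isCompact_uIcc)).mono_set
        (Set.prod_mono uIoc_subset_uIcc uIoc_subset_uIcc)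
  have h3 : (∫ x in a..b, ∫ s in (0 : ℝ)..t, et s x)
      = (∫ x in a..b, e t x) - (∫ x in a..b, e 0 x) := by
    rw [← intervalIntegral.integral_sub ((he t).intervalIntegrable _ _)
      ((he 0).intervalIntegrable _ _)]
    refine intervalIntegral.integral_congr fun x _ => ?_
    exact intervalIntegral.integral_eq_sub_of_hasDerivAt (fun s _ => hde s x)
      ((cet' x).intervalIntegrable _ _)
  have h4 : (∫ s in (0 : ℝ)..t, ∫ x in a..b, fx s x)
      = (∫ s in (0 : ℝ)..t, f s b) - ∫ s in (0 : ℝ)..t, f s a := by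
    rw [← intervalIntegral.integral_sub ((cf b).intervalIntegrable _ _)
      ((cf a).intervalIntegrable _ _)]
    refine intervalIntegral.integral_congr fun s _ => ?_
    exact intervalIntegral.integral_eq_sub_of_hasDerivAt (fun x _ => hdf s x)
      ((cfx s).intervalIntegrable _ _)
  rw [h1, h2, h3, h4]

/-- The filter of space points tending to infinity, uniformly for times in `[0, t]`. -/
def spaceInfinity (t : ℝ) : Filter (ℝ × ℝ) :=
  𝓟 (Icc 0 t) ×ˢ comap (fun x : ℝ => |x|) atTop

theorem tendsto_spaceInfinity_zero_iff {f : ℝ → ℝ → ℝ} {t : ℝ} :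
    Tendsto (fun p : ℝ × ℝ => f p.1 p.2) (spaceInfinity t) (nhds 0) ↔
      ∀ δ > (0 : ℝ), ∃ M : ℝ, ∀ x : ℝ, M ≤ |x| → ∀ s ∈ Icc (0 : ℝ) t, |f s x| ≤ δ := by
  have hb : (𝓟 (Icc (0 : ℝ) t) ×ˢ comap (fun x : ℝ => |x|) atTop).HasBasis (fun _ : ℝ => True)
      (fun M => Icc (0 : ℝ) t ×ˢ {x | M ≤ |x|}) := by
    have h := (atTop_basis (α := ℝ)).comap (fun x : ℝ => |x|)
    have h' := (hasBasis_principal (Icc (0 : ℝ) t)).prod h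
    refine ⟨fun s => (h'.mem_iff).trans ⟨?_, ?_⟩⟩
    · rintro ⟨⟨_, M⟩, _, hM⟩
      exact ⟨M, trivial, hM⟩
    · rintro ⟨M, _, hM⟩
      exact ⟨⟨(), M⟩, ⟨trivial, trivial⟩, hM⟩
  rw [spaceInfinity, hb.tendsto_iff Metric.nhds_basis_closedBall]
  simp only [Metric.mem_closedBall, dist_zero_right, Real.norm_eq_abs, true_and]
  refine forall₂_congr fun δ _ => exists_congr fun M => ⟨fun h x hx s hs => ?_, fun h p hp => ?_⟩
  · exact h (s, x) ⟨hs, hx⟩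
  · exact h p.2 hp.2 p.1 hp.1

theorem intervalIntegral_le_intervalIntegral_of_nonneg {g : ℝ → ℝ} (hg : Continuous g)
    (h0 : ∀ x, 0 ≤ g x) {R R' : ℝ} (hR : 0 ≤ R) (hRR' : R ≤ R') :
    (∫ x in (-R)..R, g x) ≤ ∫ x in (-R')..R', g x :=
  intervalIntegral.integral_mono_interval (by linarith) (by linarith) hRR'
    (Eventually.of_forall h0) (hg.intervalIntegrable _ _)

/-- Energy inequality: a dissipative balance law whose flux decays at spatial infinity. -/
theorem energy_dissipation_le {e et f fx d : ℝ → ℝ → ℝ} {t K : ℝ} (ht : 0 ≤ t)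
    (het : Continuous (fun p : ℝ × ℝ => et p.1 p.2))
    (hfx : Continuous (fun p : ℝ × ℝ => fx p.1 p.2))
    (hf : Continuous (fun p : ℝ × ℝ => f p.1 p.2))
    (hd : Continuous (fun p : ℝ × ℝ => d p.1 p.2))
    (he : ∀ t, Continuous (e t))
    (hde : ∀ t x, HasDerivAt (fun s => e s x) (et t x) t)
    (hdf : ∀ t x, HasDerivAt (fun y => f t y) (fx t x) x)
    (hbal : ∀ s ∈ Ioo 0 t, ∀ x, et s x + fx s x ≤ - d s x)
    (he0 : ∀ s x, 0 ≤ e s x) (hd0 : ∀ s x, 0 ≤ d s x)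
    (hint : Integrable (e 0)) (hK : ∫ x, e 0 x ≤ K)
    (hlim : Tendsto (fun p : ℝ × ℝ => f p.1 p.2) (spaceInfinity t) (nhds 0))
    {R : ℝ} (hR : 0 ≤ R) :
    (∫ x in (-R)..R, e t x) + (∫ s in (0 : ℝ)..t, ∫ x in (-R)..R, d s x) ≤ K := by
  refine le_of_forall_pos_le_add fun η hη => ?_
  have hδ : 0 < η / (2 * t + 1) := by positivity
  obtain ⟨M, hM⟩ := tendsto_spaceInfinity_zero_iff.1 hlim _ hδ
  set δ := η / (2 * t + 1) with hδdef
  set R' := max R M with hR'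
  have hRR' : R ≤ R' := le_max_left _ _
  have hR'0 : 0 ≤ R' := hR.trans hRR'
  have cd (s : ℝ) : Continuous (d s) := hd.comp (by fun_prop : Continuous fun x => (s, x))
  have Id (r : ℝ) : Continuous (fun s => ∫ x in (-r)..r, d s x) :=
    intervalIntegral.continuous_parametric_intervalIntegral_of_continuous' hd _ _
  have cet (s : ℝ) : Continuous (fun x => et s x + fx s x) :=
    (het.add hfx).comp (by fun_prop : Continuous fun x => (s, x))
  have Iet : Continuous (fun s => ∫ x in (-R')..R', (et s x + fx s x)) :=
    intervalIntegral.continuous_parametric_intervalIntegral_of_continuous' (het.add hfx) _ _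
  have h1 := intervalIntegral_le_intervalIntegral_of_nonneg (he t) (he0 t) hR hRR'
  have h2 : (∫ s in (0 : ℝ)..t, ∫ x in (-R)..R, d s x)
      ≤ ∫ s in (0 : ℝ)..t, ∫ x in (-R')..R', d s x :=
    intervalIntegral.integral_mono_on ht ((Id _).intervalIntegrable _ _)
      ((Id _).intervalIntegrable _ _) fun s _ =>
        intervalIntegral_le_intervalIntegral_of_nonneg (cd s) (hd0 s) hR hRR'
  have h3 := integral_balance het hfx hf he hde hdf t (-R') R'
  have h4 : (∫ s in (0 : ℝ)..t, ∫ x in (-R')..R', (et s x + fx s x))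
      ≤ ∫ s in (0 : ℝ)..t, - ∫ x in (-R')..R', d s x := by
    refine intervalIntegral.integral_mono_on_of_le_Ioo ht (Iet.intervalIntegrable _ _)
      ((Id _).neg.intervalIntegrable _ _) fun s hs => ?_
    rw [← intervalIntegral.integral_neg]
    exact intervalIntegral.integral_mono_on (by linarith) ((cet s).intervalIntegrable _ _)
      ((cd s).neg.intervalIntegrable _ _) fun x _ => hbal s hs x
  rw [intervalIntegral.integral_neg] at h4
  have h5 : (∫ x in (-R')..R', e 0 x) ≤ K := by
    refine le_trans ?_ hK
    rw [intervalIntegral.integral_of_le (by linarith)]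
    exact setIntegral_le_integral hint (Eventually.of_forall (he0 0))
  have hflux (x : ℝ) (hx : M ≤ |x|) : |∫ s in (0 : ℝ)..t, f s x| ≤ δ * t := by
    have := intervalIntegral.norm_integral_le_of_norm_le_const (a := 0) (b := t) (C := δ)
      (f := fun s => f s x) fun s hs => by
        rw [uIoc_of_le ht] at hs
        exact hM x hx s (Ioc_subset_Icc_self hs)
    simpa [abs_of_nonneg ht] using this
  have h6 := abs_le.1 (hflux R' (by rw [abs_of_nonneg hR'0]; exact le_max_right _ _))
  have h7 := abs_le.1 (hflux (-R') (by rw [abs_neg, abs_of_nonneg hR'0]; exact le_max_right _ _))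
  have h8 : δ * (2 * t + 1) = η := by rw [hδdef]; field_simp
  linarith [h6.1, h6.2, h7.1, h7.2]

/-- Bounds on all truncated space-time integrals pass to the full space-time integral. -/
theorem mul_integral_le_of_truncated {g : ℝ → ℝ → ℝ} {t c C : ℝ} (ht : 0 ≤ t) (hC : 0 ≤ C)
    (hg : Continuous (fun p : ℝ × ℝ => g p.1 p.2)) (hg0 : ∀ s x, 0 ≤ g s x)
    (hint : ∀ s ∈ Icc 0 t, Integrable (g s))
    (h : ∀ R, 0 ≤ R → c * (∫ s in (0 : ℝ)..t, ∫ x in (-R)..R, g s x) ≤ C) :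
    c * (∫ s in (0 : ℝ)..t, ∫ x, g s x) ≤ C := by
  by_cases hG : IntervalIntegrable (fun s => ∫ x, g s x) volume 0 t
  · have hI (r : ℝ) : Continuous (fun s => ∫ x in (-r)..r, g s x) :=
      intervalIntegral.continuous_parametric_intervalIntegral_of_continuous' hg _ _
    have hlim : Tendsto (fun R : ℝ => ∫ s in (0 : ℝ)..t, ∫ x in (-R)..R, g s x) atTop
        (nhds (∫ s in (0 : ℝ)..t, ∫ x, g s x)) := by
      refine intervalIntegral.tendsto_integral_filter_of_dominated_convergence
        (fun s => ∫ x, g s x) (Eventually.of_forall fun r => (hI r).aestronglyMeasurable) ?_ hG ?_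
      · filter_upwards [eventually_ge_atTop (0 : ℝ)] with R hR
        refine Eventually.of_forall fun s hs => ?_
        rw [uIoc_of_le ht] at hs
        rw [intervalIntegral.integral_of_le (by linarith), Real.norm_eq_abs,
          abs_of_nonneg (setIntegral_nonneg measurableSet_Ioc fun x _ => hg0 s x)]
        exact setIntegral_le_integral (hint s (Ioc_subset_Icc_self hs))
          (Eventually.of_forall (hg0 s))
      · refine Eventually.of_forall fun s hs => ?_
        rw [uIoc_of_le ht] at hs
        exact intervalIntegral_tendsto_integral (hint s (Ioc_subset_Icc_self hs))
          tendsto_neg_atTop_atBot tendsto_id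
    exact le_of_tendsto (hlim.const_mul c) ((eventually_ge_atTop (0 : ℝ)).mono h)
  · rwa [intervalIntegral.integral_undef hG, mul_zero]

/-- One-dimensional Sobolev inequality with weights, from truncated energy bounds. -/
theorem sq_le_of_truncated_energy {f f' : ℝ → ℝ} {β K : ℝ} (hβ : 0 < β)
    (hdf : ∀ x, HasDerivAt f (f' x) x) (hf' : Continuous f')
    (hlim : Tendsto f atBot (nhds 0))
    (h : ∀ R, 0 ≤ R → (∫ x in (-R)..R, (f x ^ 2 + β * f' x ^ 2)) ≤ K) (x : ℝ) :
    f x ^ 2 ≤ K / √β := by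
  have hr : 0 < √β := Real.sqrt_pos.2 hβ
  have hsq : √β ^ 2 = β := Real.sq_sqrt hβ.le
  have hf : Continuous f := continuous_iff_continuousAt.2 fun y => (hdf y).continuousAt
  have hbound : ∀ᶠ y in atBot, f x ^ 2 ≤ K / √β + f y ^ 2 := by
    filter_upwards [eventually_le_atBot (-|x|)] with y hy
    have hyx : y ≤ x := hy.trans (neg_abs_le x)
    have hxy : x ≤ -y := (le_abs_self x).trans (by linarith)
    have hy0 : 0 ≤ -y := (abs_nonneg x).trans (by linarith)
    have h1 : (∫ z in y..x, 2 * f z * f' z) = f x ^ 2 - f y ^ 2 := by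
      refine intervalIntegral.integral_eq_sub_of_hasDerivAt (f := fun z => f z ^ 2) (fun z _ => ?_)
        (Continuous.intervalIntegrable (by fun_prop) _ _)
      simpa using (hdf z).fun_pow 2
    have h2 : (∫ z in y..x, 2 * f z * f' z) ≤ ∫ z in y..x, (f z ^ 2 + β * f' z ^ 2) / √β := by
      refine intervalIntegral.integral_mono_on hyx
        (Continuous.intervalIntegrable (by fun_prop) _ _)
        (Continuous.intervalIntegrable (by fun_prop) _ _) fun z _ => ?_
      rw [le_div_iff₀ hr]
      nlinarith [sq_nonneg (f z - √β * f' z)]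
    have h3 : (∫ z in y..x, (f z ^ 2 + β * f' z ^ 2)) ≤ K := by
      refine le_trans ?_ (h (-y) hy0)
      refine intervalIntegral.integral_mono_interval (by linarith) hyx hxy
        (Eventually.of_forall fun z => ?_) (Continuous.intervalIntegrable (by fun_prop) _ _)
      simp only [Pi.zero_apply]
      positivity
    rw [intervalIntegral.integral_div] at h2
    have h4 := div_le_div_of_nonneg_right h3 hr.le
    linarith
  have hl : Tendsto (fun y => K / √β + f y ^ 2) atBot (nhds (K / √β + 0 ^ 2)) :=
    (hlim.pow 2).const_add _
  simpa using ge_of_tendsto hl hbound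

theorem mul_mul_le_of_abs_le {k ε : ℝ} (hk : |k| ≤ ε) (p q : ℝ) :
    k * p * q ≤ ε / 2 * (p ^ 2 + q ^ 2) := by
  obtain ⟨h1, h2⟩ := abs_le.1 hk
  nlinarith [mul_nonneg (sub_nonneg.2 h2) (sq_nonneg (p + q)),
    mul_nonneg (by linarith : 0 ≤ k + ε) (sq_nonneg (p - q))]

/-- Absorption of the cubic and mixed terms in the second energy identity. -/
theorem absorb_mixed_terms {ε β K m : ℝ} (hε : 0 < ε) (hβ : 0 < β)
    (hsmall : 36 * K * √β ≤ ε ^ 2) (hm : m ^ 2 ≤ K / √β) (a b c d : ℝ) :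
    2 * β * ε * (m * a * c) - 3 * β * (m ^ 2 * a * b) + 3 * β ^ 2 * (m ^ 2 * a * d)
      - 3 * ε * (m ^ 2 * a ^ 2) - β * ε * b ^ 2 - β ^ 2 * ε * c ^ 2 - β ^ 3 * ε * d ^ 2
    ≤ -(ε / 2 * (m ^ 2 * a ^ 2 + β * b ^ 2 + β ^ 2 * c ^ 2 + β ^ 3 * d ^ 2)) := by
  have hr : 0 < √β := Real.sqrt_pos.2 hβ
  have hsq : √β ^ 2 = β := Real.sq_sqrt hβ.le
  set r := √β
  rw [le_div_iff₀ hr] at hm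
  have hk : |6 * r * m| ≤ ε := abs_le_of_sq_le_sq (by nlinarith) hε.le
  have hk' : |-(6 * r * m)| ≤ ε := by rwa [abs_neg]
  have h1 := mul_mul_le_of_abs_le hk' (m * a) (r * b)
  have h2 := mul_mul_le_of_abs_le hk (m * a) (r ^ 3 * d)
  have h3 : 0 ≤ ε * (2 * (m * a) - r ^ 2 * c) ^ 2 := by positivity
  have h4 : 0 ≤ ε * r ^ 2 * b ^ 2 := by positivity
  have h5 : 0 ≤ ε * r ^ 6 * d ^ 2 := by positivity
  rw [← hsq]
  linear_combination h1 / 2 + h2 / 2 + h3 / 2 + h4 / 4 + h5 / 4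

namespace IsAdmissibleRLW

variable {ε β : ℝ} {u : ℝ → ℝ → ℝ}

theorem continuous_mixedD (h : IsAdmissibleRLW ε β u) (j k : ℕ) :
    Continuous (fun p : ℝ × ℝ => mixedD u j k p.1 p.2) :=
  (contDiff_mixedD h.smooth j k).continuous

theorem continuous_mixedD_space (h : IsAdmissibleRLW ε β u) (j k : ℕ) (t : ℝ) :
    Continuous (fun x => mixedD u j k t x) :=
  (h.continuous_mixedD j k).comp (by fun_prop : Continuous fun x => (t, x))

theorem tendsto_mixedD (h : IsAdmissibleRLW ε β u) {t : ℝ} (ht : 0 < t) (j k : ℕ)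
    (hjk : j + k ≤ 5) :
    Tendsto (fun p : ℝ × ℝ => mixedD u j k p.1 p.2) (spaceInfinity t) (nhds 0) :=
  tendsto_spaceInfinity_zero_iff.2 (h.decay t ht j k hjk)

theorem pde_expanded (h : IsAdmissibleRLW ε β u) {s : ℝ} (hs : 0 < s) (x : ℝ) :
    mixedD u 1 0 s x + 2 * mixedD u 0 0 s x * mixedD u 0 1 s x - β * mixedD u 1 2 s x
      + β ^ 2 * mixedD u 1 4 s x = ε * mixedD u 0 2 s x := by
  have h1 : deriv (fun y => u s y ^ 2) x = 2 * mixedD u 0 0 s x * mixedD u 0 1 s x := by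
    have := ((hasDerivAt_mixedD_space h.smooth 0 0 s x).fun_pow 2).deriv
    simpa [mixedD] using this
  rw [← h1]
  exact h.pde s hs x

/-- The basic energy estimate on a truncated domain. -/
theorem truncated_energy_le (h : IsAdmissibleRLW ε β u) (hε : 0 < ε) (hβ : 0 < β) {K : ℝ}
    (hK : sqL2 (u 0) + β * sqL2 (fun x => mixedD u 0 1 0 x)
      + β ^ 2 * sqL2 (fun x => mixedD u 0 2 0 x) ≤ K) {t : ℝ} (ht : 0 < t) {R : ℝ} (hR : 0 ≤ R) :
    (∫ x in (-R)..R, (mixedD u 0 0 t x ^ 2 + β * mixedD u 0 1 t x ^ 2)) ≤ K := by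
  have c := h.continuous_mixedD
  have cs := h.continuous_mixedD_space
  have dt := hasDerivAt_mixedD_time h.smooth
  have dx := hasDerivAt_mixedD_space h.smooth
  have i00 := h.sq_int t ht 0 0 (by norm_num) 0 ⟨le_rfl, ht.le⟩
  have i01 := h.sq_int t ht 0 1 (by norm_num) 0 ⟨le_rfl, ht.le⟩
  have i02 := h.sq_int t ht 0 2 (by norm_num) 0 ⟨le_rfl, ht.le⟩
  have c00 := c 0 0
  have c01 := c 0 1
  have c02 := c 0 2
  have c10 := c 1 0
  have c11 := c 1 1
  have c12 := c 1 2
  have c13 := c 1 3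
  have c14 := c 1 4
  have l := h.tendsto_mixedD ht
  have key := energy_dissipation_le (t := t) (K := K) (R := R)
    (e := fun s x => mixedD u 0 0 s x ^ 2 + β * mixedD u 0 1 s x ^ 2 + β ^ 2 * mixedD u 0 2 s x ^ 2)
    (et := fun s x => 2 * (mixedD u 0 0 s x * mixedD u 1 0 s x
      + β * (mixedD u 0 1 s x * mixedD u 1 1 s x) + β ^ 2 * (mixedD u 0 2 s x * mixedD u 1 2 s x)))
    (f := fun s x => 4 / 3 * mixedD u 0 0 s x ^ 3 - 2 * β * (mixedD u 0 0 s x * mixedD u 1 1 s x)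
      + 2 * β ^ 2 * (mixedD u 0 0 s x * mixedD u 1 3 s x - mixedD u 0 1 s x * mixedD u 1 2 s x)
      - 2 * ε * (mixedD u 0 0 s x * mixedD u 0 1 s x))
    (fx := fun s x => 4 * mixedD u 0 0 s x ^ 2 * mixedD u 0 1 s x
      - 2 * β * (mixedD u 0 1 s x * mixedD u 1 1 s x + mixedD u 0 0 s x * mixedD u 1 2 s x)
      + 2 * β ^ 2 * (mixedD u 0 0 s x * mixedD u 1 4 s x - mixedD u 0 2 s x * mixedD u 1 2 s x)
      - 2 * ε * (mixedD u 0 1 s x ^ 2 + mixedD u 0 0 s x * mixedD u 0 2 s x))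
    (d := fun s x => 2 * ε * mixedD u 0 1 s x ^ 2) ht.le
    (by fun_prop) (by fun_prop) (by fun_prop) (by fun_prop)
    (fun s => by have := cs 0 0 s; have := cs 0 1 s; have := cs 0 2 s; fun_prop)
    (fun s x => ((((dt 0 0 s x).fun_pow 2).fun_add (((dt 0 1 s x).fun_pow 2).const_mul β)).fun_add
      (((dt 0 2 s x).fun_pow 2).const_mul (β ^ 2))).congr_deriv (by norm_num; ring))
    (fun s x => ((((((dx 0 0 s x).fun_pow 3).const_mul (4 / 3)).fun_sub
      (((dx 0 0 s x).fun_mul (dx 1 1 s x)).const_mul (2 * β))).fun_add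
      ((((dx 0 0 s x).fun_mul (dx 1 3 s x)).fun_sub
        ((dx 0 1 s x).fun_mul (dx 1 2 s x))).const_mul (2 * β ^ 2))).fun_sub
      (((dx 0 0 s x).fun_mul (dx 0 1 s x)).const_mul (2 * ε))).congr_deriv (by norm_num; ring))
    (fun s hs x => le_of_eq (by
      linear_combination 2 * mixedD u 0 0 s x * h.pde_expanded hs.1 x))
    (fun s x => by positivity) (fun s x => by positivity)
    ((i00.add (i01.const_mul β)).add (i02.const_mul (β ^ 2)))
    (by
      rw [integral_add (f := fun x => mixedD u 0 0 0 x ^ 2 + β * mixedD u 0 1 0 x ^ 2)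
          (i00.add (i01.const_mul β)) (i02.const_mul (β ^ 2)),
        integral_add i00 (i01.const_mul β), integral_const_mul, integral_const_mul]
      simpa [sqL2, mixedD] using hK)
    (by
      have l00 := l 0 0 (by norm_num)
      have l01 := l 0 1 (by norm_num)
      simpa using ((((l00.pow 3).const_mul (4 / 3)).sub
        ((l00.mul (l 1 1 (by norm_num))).const_mul (2 * β))).add
        (((l00.mul (l 1 3 (by norm_num))).sub
          (l01.mul (l 1 2 (by norm_num)))).const_mul (2 * β ^ 2))).sub
        ((l00.mul l01).const_mul (2 * ε))) hR
  have h1 : (∫ x in (-R)..R, (mixedD u 0 0 t x ^ 2 + β * mixedD u 0 1 t x ^ 2))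
      ≤ ∫ x in (-R)..R, (mixedD u 0 0 t x ^ 2 + β * mixedD u 0 1 t x ^ 2
        + β ^ 2 * mixedD u 0 2 t x ^ 2) := by
    have := cs 0 0 t
    have := cs 0 1 t
    have := cs 0 2 t
    refine intervalIntegral.integral_mono_on (by linarith)
      (Continuous.intervalIntegrable (by fun_prop) _ _)
      (Continuous.intervalIntegrable (by fun_prop) _ _) fun x _ => ?_
    have : 0 ≤ β ^ 2 * mixedD u 0 2 t x ^ 2 := by positivity
    linarith
  have h2 : 0 ≤ ∫ s in (0 : ℝ)..t, ∫ x in (-R)..R, 2 * ε * mixedD u 0 1 s x ^ 2 :=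
    intervalIntegral.integral_nonneg ht.le fun s _ =>
      intervalIntegral.integral_nonneg (by linarith) fun x _ => by positivity
  linarith

/-- The uniform bound on the solution provided by the energy estimate. -/
theorem sq_mixedD_zero_le (h : IsAdmissibleRLW ε β u) (hε : 0 < ε) (hβ : 0 < β) {K : ℝ}
    (hK : sqL2 (u 0) + β * sqL2 (fun x => mixedD u 0 1 0 x)
      + β ^ 2 * sqL2 (fun x => mixedD u 0 2 0 x) ≤ K) {t : ℝ} (ht : 0 < t) (x : ℝ) :
    mixedD u 0 0 t x ^ 2 ≤ K / √β := by
  refine sq_le_of_truncated_energy (f := mixedD u 0 0 t) hβ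
    (hasDerivAt_mixedD_space h.smooth 0 0 t) (h.continuous_mixedD_space 0 1 t) ?_
    (fun R hR => h.truncated_energy_le hε hβ hK ht hR) x
  refine (h.tendsto_mixedD ht 0 0 (by norm_num)).comp (f := fun y : ℝ => (t, y)) ?_
  refine Tendsto.prodMk (tendsto_principal.2 (Eventually.of_forall fun _ => ⟨ht.le, le_rfl⟩)) ?_
  exact tendsto_comap_iff.2 tendsto_abs_atBot_atTop

theorem exists_abs_mixedD_zero_le (h : IsAdmissibleRLW ε β u) {t : ℝ} (ht : 0 ≤ t) :
    ∃ B : ℝ, ∀ x, |mixedD u 0 0 t x| ≤ B := by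
  obtain ⟨M, hM⟩ := h.decay (t + 1) (by linarith) 0 0 (by norm_num) 1 one_pos
  obtain ⟨B, hB⟩ := (isCompact_Icc (a := -M) (b := M)).exists_bound_of_continuousOn
    (h.continuous_mixedD_space 0 0 t).continuousOn
  refine ⟨max 1 B, fun x => ?_⟩
  rcases le_total M |x| with hx | hx
  · exact (hM x hx t ⟨ht, by linarith⟩).trans (le_max_left _ _)
  · exact (hB x (abs_le.1 hx)).trans (le_max_right _ _)

theorem integrable_sq_mul (h : IsAdmissibleRLW ε β u) {t : ℝ} (ht : 0 ≤ t) {k : ℕ} (hk : k ≤ 5) :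
    Integrable (fun x => (mixedD u 0 0 t x * mixedD u 0 k t x) ^ 2) := by
  obtain ⟨B, hB⟩ := h.exists_abs_mixedD_zero_le ht
  have hi := h.sq_int (t + 1) (by linarith) 0 k (by omega) t ⟨ht, by linarith⟩
  simp only [mul_pow]
  refine hi.bdd_mul (c := B ^ 2)
    ((h.continuous_mixedD_space 0 0 t).pow 2).aestronglyMeasurable
    (Eventually.of_forall fun x => ?_)
  rw [Real.norm_eq_abs, abs_pow]
  exact pow_le_pow_left₀ (abs_nonneg _) (hB x) 2

/-- The second energy estimate, controlling the space-time dissipation on a truncated domain. -/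
theorem truncated_dissipation_le (h : IsAdmissibleRLW ε β u) (hε : 0 < ε) (hβ : 0 < β) {K : ℝ}
    (hsmall : 36 * K * √β ≤ ε ^ 2) (hdata : DataBoundsRLW ε β K (u 0))
    (hK : sqL2 (u 0) + β * sqL2 (fun x => mixedD u 0 1 0 x)
      + β ^ 2 * sqL2 (fun x => mixedD u 0 2 0 x) ≤ K) {t : ℝ} (ht : 0 < t) {R : ℝ} (hR : 0 ≤ R) :
    (∫ s in (0 : ℝ)..t, ∫ x in (-R)..R, ε / 2 * (mixedD u 0 0 s x ^ 2 * mixedD u 0 1 s x ^ 2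
      + β * mixedD u 1 1 s x ^ 2 + β ^ 2 * mixedD u 1 2 s x ^ 2
      + β ^ 3 * mixedD u 1 3 s x ^ 2)) ≤ K := by
  have c := h.continuous_mixedD
  have cs := h.continuous_mixedD_space
  have dt := hasDerivAt_mixedD_time h.smooth
  have dx := hasDerivAt_mixedD_space h.smooth
  have i02 := h.sq_int t ht 0 2 (by norm_num) 0 ⟨le_rfl, ht.le⟩
  have i4 : Integrable (fun x => mixedD u 0 0 0 x ^ 4) :=
    (h.integrable_sq_mul le_rfl (k := 0) (by norm_num)).congr
      (Eventually.of_forall fun x => by ring)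
  have c00 := c 0 0
  have c01 := c 0 1
  have c02 := c 0 2
  have c10 := c 1 0
  have c11 := c 1 1
  have c12 := c 1 2
  have c13 := c 1 3
  have c14 := c 1 4
  have l := h.tendsto_mixedD ht
  have key := energy_dissipation_le (t := t) (K := K) (R := R)
    (e := fun s x => 1 / 4 * mixedD u 0 0 s x ^ 4 + β * ε ^ 2 / 2 * mixedD u 0 2 s x ^ 2)
    (et := fun s x => mixedD u 0 0 s x ^ 3 * mixedD u 1 0 s x
      + β * ε ^ 2 * (mixedD u 0 2 s x * mixedD u 1 2 s x))
    (f := fun s x => 2 / 5 * mixedD u 0 0 s x ^ 5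
      - mixedD u 0 0 s x ^ 3 *
        (β * mixedD u 1 1 s x - β ^ 2 * mixedD u 1 3 s x + ε * mixedD u 0 1 s x)
      - β * ε * (mixedD u 1 0 s x * mixedD u 1 1 s x)
      - β ^ 3 * ε * (mixedD u 1 3 s x * mixedD u 1 2 s x))
    (fx := fun s x => 2 * mixedD u 0 0 s x ^ 4 * mixedD u 0 1 s x
      - (3 * mixedD u 0 0 s x ^ 2 * mixedD u 0 1 s x *
          (β * mixedD u 1 1 s x - β ^ 2 * mixedD u 1 3 s x + ε * mixedD u 0 1 s x)
        + mixedD u 0 0 s x ^ 3 *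
          (β * mixedD u 1 2 s x - β ^ 2 * mixedD u 1 4 s x + ε * mixedD u 0 2 s x))
      - β * ε * (mixedD u 1 1 s x ^ 2 + mixedD u 1 0 s x * mixedD u 1 2 s x)
      - β ^ 3 * ε * (mixedD u 1 4 s x * mixedD u 1 2 s x + mixedD u 1 3 s x ^ 2))
    (d := fun s x => ε / 2 * (mixedD u 0 0 s x ^ 2 * mixedD u 0 1 s x ^ 2
      + β * mixedD u 1 1 s x ^ 2 + β ^ 2 * mixedD u 1 2 s x ^ 2
      + β ^ 3 * mixedD u 1 3 s x ^ 2)) ht.le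
    (by fun_prop) (by fun_prop) (by fun_prop) (by fun_prop)
    (fun s => by have := cs 0 0 s; have := cs 0 2 s; fun_prop)
    (fun s x => ((((dt 0 0 s x).fun_pow 4).const_mul (1 / 4)).fun_add
      (((dt 0 2 s x).fun_pow 2).const_mul (β * ε ^ 2 / 2))).congr_deriv (by norm_num; ring))
    (fun s x => ((((((dx 0 0 s x).fun_pow 5).const_mul (2 / 5)).fun_sub
      (((dx 0 0 s x).fun_pow 3).fun_mul ((((dx 1 1 s x).const_mul β).fun_sub
        ((dx 1 3 s x).const_mul (β ^ 2))).fun_add ((dx 0 1 s x).const_mul ε)))).fun_sub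
      (((dx 1 0 s x).fun_mul (dx 1 1 s x)).const_mul (β * ε))).fun_sub
      (((dx 1 3 s x).fun_mul (dx 1 2 s x)).const_mul (β ^ 3 * ε))).congr_deriv
        (by norm_num; ring))
    (fun s hs x => by
      have hab := absorb_mixed_terms hε hβ hsmall (h.sq_mixedD_zero_le hε hβ hK hs.1 x)
        (mixedD u 0 1 s x) (mixedD u 1 1 s x) (mixedD u 1 2 s x) (mixedD u 1 3 s x)
      refine le_trans (le_of_eq ?_) hab
      linear_combination (mixedD u 0 0 s x ^ 3 - β * ε * mixedD u 1 2 s x)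
        * h.pde_expanded hs.1 x)
    (fun s x => by positivity) (fun s x => by positivity)
    ((i4.const_mul (1 / 4)).add (i02.const_mul (β * ε ^ 2 / 2)))
    (by
      rw [integral_add (i4.const_mul (1 / 4)) (i02.const_mul (β * ε ^ 2 / 2)),
        integral_const_mul, integral_const_mul]
      have h2 : 0 ≤ ∫ x, u 0 x ^ 2 := integral_nonneg fun x => by positivity
      have h4 : 0 ≤ ∫ x, u 0 x ^ 4 := integral_nonneg fun x => by positivity
      have hx : 0 ≤ β * ε ^ 2 * ∫ x, iteratedDeriv 2 (u 0) x ^ 2 :=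
        mul_nonneg (by positivity) (integral_nonneg fun x => by positivity)
      simp only [mixedD, iteratedDeriv_zero]
      unfold DataBoundsRLW at hdata
      linarith)
    (by
      have l00 := l 0 0 (by norm_num)
      have l11 := l 1 1 (by norm_num)
      have l13 := l 1 3 (by norm_num)
      simpa using ((((l00.pow 5).const_mul (2 / 5)).sub
        ((l00.pow 3).mul (((l11.const_mul β).sub (l13.const_mul (β ^ 2))).add
          ((l 0 1 (by norm_num)).const_mul ε)))).sub
        (((l 1 0 (by norm_num)).mul l11).const_mul (β * ε))).sub
        ((l13.mul (l 1 2 (by norm_num))).const_mul (β ^ 3 * ε))) hR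
  have h1 : 0 ≤ ∫ x in (-R)..R,
      (1 / 4 * mixedD u 0 0 t x ^ 4 + β * ε ^ 2 / 2 * mixedD u 0 2 t x ^ 2) :=
    intervalIntegral.integral_nonneg (by linarith) fun x _ => by positivity
  linarith

/-- Any nonnegative quantity controlled by the dissipation density has a bounded space-time
integral. -/
theorem mul_integral_le_of_le_dissipation (h : IsAdmissibleRLW ε β u) (hε : 0 < ε) (hβ : 0 < β)
    {K : ℝ} (hsmall : 36 * K * √β ≤ ε ^ 2) (hdata : DataBoundsRLW ε β K (u 0))
    (hK : sqL2 (u 0) + β * sqL2 (fun x => mixedD u 0 1 0 x)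
      + β ^ 2 * sqL2 (fun x => mixedD u 0 2 0 x) ≤ K) {t : ℝ} (ht : 0 < t)
    {g : ℝ → ℝ → ℝ} {c : ℝ} (hg : Continuous (fun p : ℝ × ℝ => g p.1 p.2))
    (hint : ∀ s ∈ Icc 0 t, Integrable (fun x => g s x ^ 2))
    (hle : ∀ s x, c * g s x ^ 2 ≤ ε * (mixedD u 0 0 s x ^ 2 * mixedD u 0 1 s x ^ 2
      + β * mixedD u 1 1 s x ^ 2 + β ^ 2 * mixedD u 1 2 s x ^ 2
      + β ^ 3 * mixedD u 1 3 s x ^ 2)) :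
    c * (∫ s in (0 : ℝ)..t, sqL2 (g s)) ≤ 2 * K := by
  have hdiss (R : ℝ) (hR : 0 ≤ R) := h.truncated_dissipation_le hε hβ hsmall hdata hK ht hR
  have hK0 : 0 ≤ K := by simpa using hdiss 0 le_rfl
  have c00 := h.continuous_mixedD 0 0
  have c01 := h.continuous_mixedD 0 1
  have c11 := h.continuous_mixedD 1 1
  have c12 := h.continuous_mixedD 1 2
  have c13 := h.continuous_mixedD 1 3
  have hD : Continuous (fun p : ℝ × ℝ => ε / 2 * (mixedD u 0 0 p.1 p.2 ^ 2 *
      mixedD u 0 1 p.1 p.2 ^ 2 + β * mixedD u 1 1 p.1 p.2 ^ 2 + β ^ 2 * mixedD u 1 2 p.1 p.2 ^ 2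
      + β ^ 3 * mixedD u 1 3 p.1 p.2 ^ 2)) := by fun_prop
  have hg2 : Continuous (fun p : ℝ × ℝ => c / 2 * g p.1 p.2 ^ 2) := by fun_prop
  refine mul_integral_le_of_truncated (g := fun s x => g s x ^ 2) ht.le (by positivity)
    (hg.pow 2) (fun s x => sq_nonneg _) hint fun R hR => ?_
  have hmono : (∫ s in (0 : ℝ)..t, ∫ x in (-R)..R, c / 2 * g s x ^ 2) ≤ K := by
    refine le_trans ?_ (hdiss R hR)
    refine intervalIntegral.integral_mono_on ht.le
      ((intervalIntegral.continuous_parametric_intervalIntegral_of_continuous'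
        hg2 _ _).intervalIntegrable _ _)
      ((intervalIntegral.continuous_parametric_intervalIntegral_of_continuous'
        hD _ _).intervalIntegrable _ _) fun s _ => ?_
    refine intervalIntegral.integral_mono_on (by linarith)
      ((hg2.comp (by fun_prop : Continuous fun x => (s, x))).intervalIntegrable _ _)
      ((hD.comp (by fun_prop : Continuous fun x => (s, x))).intervalIntegrable _ _) fun x _ => ?_
    linarith [hle s x]
  simp only [intervalIntegral.integral_const_mul] at hmono
  linarith

end IsAdmissibleRLW

/-- Space–time integral bounds for the Rosenau–RLW approximation (★★). -/
theorem spacetime_bounds_RLW (C0 : ℝ) (hC0 : 0 < C0) :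
    ∃ D : ℝ, 0 < D ∧ ∃ C : ℝ, 0 < C ∧
      ∀ ε β : ℝ, 0 < ε → 0 < β → β ≤ D ^ 2 * ε ^ 4 →
        ∀ u : ℝ → ℝ → ℝ, IsAdmissibleRLW ε β u →
          DataBoundsRLW ε β C0 (u 0) →
          (sqL2 (u 0) + β * sqL2 (fun x => mixedD u 0 1 0 x)
            + β ^ 2 * sqL2 (fun x => mixedD u 0 2 0 x) ≤ C0) →
          ∀ t > (0 : ℝ),
            β * ε * (∫ s in (0 : ℝ)..t, sqL2 (fun x => mixedD u 1 1 s x)) ≤ C ∧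
            β ^ 2 * ε * (∫ s in (0 : ℝ)..t, sqL2 (fun x => mixedD u 1 2 s x)) ≤ C ∧
            β ^ 3 * ε * (∫ s in (0 : ℝ)..t, sqL2 (fun x => mixedD u 1 3 s x)) ≤ C ∧
            ε * (∫ s in (0 : ℝ)..t, sqL2 (fun x => u s x * mixedD u 0 1 s x)) ≤ C := by
  refine ⟨1 / (36 * C0), by positivity, 2 * C0, by positivity, ?_⟩
  intro ε β hε hβ hβε u hu hdata hK t ht
  have hsmall : 36 * C0 * √β ≤ ε ^ 2 := by
    have h1 : √β ≤ 1 / (36 * C0) * ε ^ 2 :=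
      Real.sqrt_le_iff.2 ⟨by positivity, hβε.trans (le_of_eq (by ring))⟩
    calc 36 * C0 * √β ≤ 36 * C0 * (1 / (36 * C0) * ε ^ 2) := by gcongr
      _ = ε ^ 2 := by field_simp
  have hi (j k : ℕ) (hjk : j + k ≤ 5) := hu.sq_int t ht j k hjk
  have hc := hu.continuous_mixedD
  have nonneg (s x : ℝ) : 0 ≤ ε * (mixedD u 0 0 s x ^ 2 * mixedD u 0 1 s x ^ 2) ∧
      0 ≤ ε * (β * mixedD u 1 1 s x ^ 2) ∧ 0 ≤ ε * (β ^ 2 * mixedD u 1 2 s x ^ 2) ∧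
      0 ≤ ε * (β ^ 3 * mixedD u 1 3 s x ^ 2) :=
    ⟨by positivity, by positivity, by positivity, by positivity⟩
  refine ⟨?_, ?_, ?_, ?_⟩
  · exact hu.mul_integral_le_of_le_dissipation hε hβ hsmall hdata hK ht (hc 1 1)
      (hi 1 1 (by norm_num)) fun s x => by linarith [nonneg s x]
  · exact hu.mul_integral_le_of_le_dissipation hε hβ hsmall hdata hK ht (hc 1 2)
      (hi 1 2 (by norm_num)) fun s x => by linarith [nonneg s x]
  · exact hu.mul_integral_le_of_le_dissipation hε hβ hsmall hdata hK ht (hc 1 3)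
      (hi 1 3 (by norm_num)) fun s x => by linarith [nonneg s x]
  · exact hu.mul_integral_le_of_le_dissipation hε hβ hsmall hdata hK ht
      (g := fun s x => mixedD u 0 0 s x * mixedD u 0 1 s x) ((hc 0 0).mul (hc 0 1))
      (fun s hs => hu.integrable_sq_mul hs.1 (by norm_num))
      fun s x => by rw [mul_pow]; linarith [nonneg s x]

end
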